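/- Let α₁,…,αₙ ∈ ℤ^d be linearly independent integer vectors, θ ⊆ {1,…,n}, and k ∈ {1,…,n} with k ∉ θ. Then, in the fraction field F, σ(𝒞^θ(α₁,…,αₙ)) + σ(𝒞^θ(α₁,…,α_{k−1},−α_k,α_{k+1},…,αₙ)) = σ(𝒞^θ(α₁,…,α_{k−1},α_{k+1},…,αₙ)), where the last cone has n−1 generators (the k-th generator deleted) and θ is regarded as a subset of the remaining indices. Moreover, σ(𝒞^{θ∪{k}}(α₁,…,αₙ)) + σ(𝒞^{θ}(α₁,…,α_{k−1},−α_k,α_{k+1},…,αₙ)) = 0. -/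

import Mathlib

noncomputable section
open scoped BigOperators

/-- The group algebra `ℚ[ℤ^d]` (Laurent polynomials in `d` variables over `ℚ`). -/
abbrev GroupAlg (d : ℕ) : Type := AddMonoidAlgebra ℚ (Fin d → ℤ)

instance (d : ℕ) : IsDomain (GroupAlg d) := NoZeroDivisors.to_isDomain _

/-- The fraction field `F` of `ℚ[ℤ^d]`. -/
abbrev FracF (d : ℕ) : Type := FractionRing (GroupAlg d)

/-- The monomial `x^m` for `m ∈ ℤ^d`, viewed inside the fraction field. -/
def xpow {d : ℕ} (m : Fin d → ℤ) : FracF d :=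
  algebraMap (GroupAlg d) (FracF d) (AddMonoidAlgebra.single m 1)

/-- The lattice points of the half-open fundamental parallelepiped `Π^θ` of the
tuple `b = (b₁,…,bₙ)`: points `Σ tᵢ bᵢ` with `tᵢ ∈ [0,1)` for `i ∉ θ` and
`tᵢ ∈ (0,1]` for `i ∈ θ`. -/
def parPts {d n : ℕ} (b : Fin n → Fin d → ℤ) (θ : Finset (Fin n)) : Set (Fin d → ℤ) :=
  {m | ∃ t : Fin n → ℝ,
    (∀ i ∉ θ, 0 ≤ t i ∧ t i < 1) ∧ (∀ i ∈ θ, 0 < t i ∧ t i ≤ 1) ∧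
    (fun j => (m j : ℝ)) = ∑ i, t i • (fun j => (b i j : ℝ))}

/-- The rational generating function `σ(𝒞^θ(b₁,…,bₙ))
  = (Σ_{m ∈ Π^θ ∩ ℤ^d} x^m) / ∏ᵢ (1 − x^{bᵢ}) ∈ F`. -/
def sigmaGF {d n : ℕ} (b : Fin n → Fin d → ℤ) (θ : Finset (Fin n)) : FracF d :=
  (∑ᶠ m ∈ parPts b θ, xpow m) / ∏ i, (1 - xpow (b i))

/-- Lattice points whose `k`-th coefficient lies in `I`, the other ones being constrained by `θ`. -/
def slab {d n : ℕ} (α : Fin (n + 1) → Fin d → ℤ) (θ : Finset (Fin (n + 1))) (k : Fin (n + 1))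
    (I : Set ℝ) : Set (Fin d → ℤ) :=
  {m | ∃ s ∈ I, ∃ t : Fin n → ℝ,
    (∀ i, k.succAbove i ∉ θ → 0 ≤ t i ∧ t i < 1) ∧
    (∀ i, k.succAbove i ∈ θ → 0 < t i ∧ t i ≤ 1) ∧
    ∀ j, (m j : ℝ) = s * (α k j : ℝ) + ∑ i, t i * (α (k.succAbove i) j : ℝ)}

theorem real_indep {d n : ℕ} (α : Fin n → Fin d → ℤ) (hα : LinearIndependent ℤ α)
    (c : Fin n → ℝ) (hc : ∀ j, ∑ i, c i * (α i j : ℝ) = 0) : ∀ i, c i = 0 := by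
  let φ : (Fin d → ℤ) →ₗ[ℤ] (Fin d → ℚ) :=
    { toFun := fun m j => (m j : ℚ)
      map_add' := by intro x y; ext j; simp
      map_smul' := by intro r x; ext j; simp }
  have hφ : LinearMap.ker φ = ⊥ := by
    rw [LinearMap.ker_eq_bot]
    intro x y h
    ext j
    have := congrFun h j
    simpa [φ] using this
  have h1 := hα.map' φ hφ
  rw [LinearIndependent.iff_fractionRing ℤ ℚ, Fintype.linearIndependent_iff] at h1
  intro i
  rw [← Module.forall_dual_apply_eq_zero_iff ℚ (c i)]
  intro f
  refine h1 (fun i => f (c i)) ?_ i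
  ext j
  have h2 := congrArg f (hc j)
  rw [map_sum, map_zero] at h2
  simp only [Finset.sum_apply, Pi.smul_apply, Pi.zero_apply, smul_eq_mul, Function.comp]
  rw [← h2]
  refine Finset.sum_congr rfl fun i _ => ?_
  have : c i * (α i j : ℝ) = (α i j : ℤ) • c i := by rw [zsmul_eq_mul, mul_comm]
  rw [this, map_zsmul, zsmul_eq_mul, mul_comm]
  rfl

theorem xpow_add {d : ℕ} (a b : Fin d → ℤ) : xpow (a + b) = xpow a * xpow b := by
  unfold xpow
  rw [← map_mul, AddMonoidAlgebra.single_mul_single, one_mul]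

theorem xpow_zero {d : ℕ} : xpow (0 : Fin d → ℤ) = 1 := by
  unfold xpow
  rw [← AddMonoidAlgebra.one_def, map_one]

theorem xpow_ne_one {d : ℕ} (a : Fin d → ℤ) (ha : a ≠ 0) : xpow a ≠ 1 := by
  intro h
  rw [← xpow_zero] at h
  unfold xpow at h
  have h2 := IsFractionRing.injective (GroupAlg d) (FracF d) h
  have h3 := AddMonoidAlgebra.of_injective (R := ℚ) (M := Fin d → ℤ) h2
  exact ha h3

section slab
variable {d n : ℕ} (α : Fin (n + 1) → Fin d → ℤ) (θ : Finset (Fin (n + 1))) (k : Fin (n + 1))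

theorem slab_finite (I : Set ℝ) (hI : ∀ s ∈ I, |s| ≤ 1) : (slab α θ k I).Finite := by
  let B : Fin d → ℤ := fun j => |α k j| + ∑ i, |α (k.succAbove i) j|
  refine (Set.finite_Icc (-B) B).subset ?_
  rintro m ⟨s, hs, t, h0, h1, hm⟩
  have ht : ∀ i, |t i| ≤ 1 := by
    intro i
    rw [abs_le]
    by_cases h : k.succAbove i ∈ θ
    · have := h1 i h
      constructor <;> linarith
    · have := h0 i h
      constructor <;> linarith
  have key : ∀ j, |m j| ≤ B j := by
    intro j
    have : |(m j : ℝ)| ≤ (B j : ℝ) := by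
      rw [hm j]
      refine (abs_add_le _ _).trans ?_
      simp only [B]
      push_cast
      refine add_le_add ?_ ((Finset.abs_sum_le_sum_abs _ _).trans (Finset.sum_le_sum fun i _ => ?_))
      · rw [abs_mul]
        exact mul_le_of_le_one_left (abs_nonneg _) (hI s hs)
      · rw [abs_mul]
        exact mul_le_of_le_one_left (abs_nonneg _) (ht i)
    exact_mod_cast this
  exact ⟨fun j => (abs_le.mp (key j)).1, fun j => (abs_le.mp (key j)).2⟩

theorem slab_union (I J : Set ℝ) : slab α θ k (I ∪ J) = slab α θ k I ∪ slab α θ k J := by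
  ext m
  constructor
  · rintro ⟨s, hs | hs, h⟩
    · exact Or.inl ⟨s, hs, h⟩
    · exact Or.inr ⟨s, hs, h⟩
  · rintro (⟨s, hs, h⟩ | ⟨s, hs, h⟩)
    · exact ⟨s, Or.inl hs, h⟩
    · exact ⟨s, Or.inr hs, h⟩

theorem slab_disjoint (hα : LinearIndependent ℤ α) (I J : Set ℝ) (h : Disjoint I J) :
    Disjoint (slab α θ k I) (slab α θ k J) := by
  rw [Set.disjoint_left]
  rintro m ⟨s, hs, t, -, -, hm⟩ ⟨s', hs', t', -, -, hm'⟩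
  have := real_indep α hα (k.insertNth (s - s') (fun i => t i - t' i)) (by
    intro j
    rw [Fin.sum_univ_succAbove _ k]
    simp only [Fin.insertNth_apply_same, Fin.insertNth_apply_succAbove, sub_mul,
      Finset.sum_sub_distrib]
    linarith [hm j, hm' j]) k
  simp only [Fin.insertNth_apply_same] at this
  have : s = s' := by linarith
  subst this
  exact Set.disjoint_left.mp h hs hs'

theorem slab_shift (I J : Set ℝ) (h : ∀ s, s ∈ I ↔ s + 1 ∈ J) :
    slab α θ k J = (fun m => α k + m) '' slab α θ k I := by
  ext m
  constructor
  · rintro ⟨s, hs, t, h0, h1, hm⟩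
    refine ⟨m - α k, ⟨s - 1, (h _).2 (by simpa using hs), t, h0, h1, fun j => ?_⟩, by simp⟩
    rw [Pi.sub_apply, Int.cast_sub, hm j]
    ring
  · rintro ⟨m, ⟨s, hs, t, h0, h1, hm⟩, rfl⟩
    refine ⟨s + 1, (h _).1 hs, t, h0, h1, fun j => ?_⟩
    change ((α k j + m j : ℤ) : ℝ) = _
    rw [Int.cast_add, hm j]
    ring

theorem sum_shift (I J : Set ℝ) (h : ∀ s, s ∈ I ↔ s + 1 ∈ J) :
    ∑ᶠ m ∈ slab α θ k J, xpow m = xpow (α k) * ∑ᶠ m ∈ slab α θ k I, xpow m := by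
  rw [slab_shift α θ k I J h, finsum_mem_image (add_right_injective _).injOn, mul_finsum_mem]
  simp only [xpow_add]

theorem parPts_eq (hk : k ∉ θ) : parPts α θ = slab α θ k (Set.Ico 0 1) := by
  ext m
  constructor
  · rintro ⟨t, h0, h1, hm⟩
    refine ⟨t k, h0 k hk, fun i => t (k.succAbove i), fun i => h0 _, fun i => h1 _, fun j => ?_⟩
    have := congrFun hm j
    rw [Fin.sum_univ_succAbove _ k] at this
    simpa using this
  · rintro ⟨s, hs, t, h0, h1, hm⟩
    refine ⟨k.insertNth s t, ?_, ?_, ?_⟩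
    · intro i hi
      rcases Fin.eq_self_or_eq_succAbove k i with rfl | ⟨i, rfl⟩
      · simpa using hs
      · simpa using h0 i hi
    · intro i hi
      rcases Fin.eq_self_or_eq_succAbove k i with rfl | ⟨i, rfl⟩
      · exact absurd hi hk
      · simpa using h1 i hi
    · ext j
      rw [Fin.sum_univ_succAbove _ k]
      simpa using hm j

theorem parPts_insert_eq (hk : k ∉ θ) :
    parPts α (insert k θ) = slab α θ k (Set.Ioc 0 1) := by
  have hne : ∀ i, k.succAbove i ∈ insert k θ ↔ k.succAbove i ∈ θ := by
    intro i
    simp [Fin.succAbove_ne]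
  ext m
  constructor
  · rintro ⟨t, h0, h1, hm⟩
    refine ⟨t k, h1 k (by simp), fun i => t (k.succAbove i),
      fun i hi => h0 _ (by rwa [hne]), fun i hi => h1 _ (by rwa [hne]), fun j => ?_⟩
    have := congrFun hm j
    rw [Fin.sum_univ_succAbove _ k] at this
    simpa using this
  · rintro ⟨s, hs, t, h0, h1, hm⟩
    refine ⟨k.insertNth s t, ?_, ?_, ?_⟩
    · intro i hi
      rcases Fin.eq_self_or_eq_succAbove k i with rfl | ⟨i, rfl⟩
      · simp at hi
      · rw [hne] at hi
        simpa using h0 i hi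
    · intro i hi
      rcases Fin.eq_self_or_eq_succAbove k i with rfl | ⟨i, rfl⟩
      · simpa using hs
      · rw [hne] at hi
        simpa using h1 i hi
    · ext j
      rw [Fin.sum_univ_succAbove _ k]
      simpa using hm j

theorem parPts_neg_eq (hk : k ∉ θ) :
    parPts (Function.update α k (-α k)) θ = slab α θ k (Set.Ioc (-1) 0) := by
  rw [parPts_eq _ _ k hk]
  ext m
  constructor
  · rintro ⟨s, hs, t, h0, h1, hm⟩
    refine ⟨-s, ⟨by linarith [hs.2], by linarith [hs.1]⟩, t, h0, h1, fun j => ?_⟩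
    simpa [Fin.succAbove_ne] using hm j
  · rintro ⟨s, hs, t, h0, h1, hm⟩
    refine ⟨-s, ⟨by linarith [hs.2], by linarith [hs.1]⟩, t, h0, h1, fun j => ?_⟩
    simpa [Fin.succAbove_ne] using hm j

theorem parPts_del_eq :
    parPts (fun m : Fin n => α (k.succAbove m))
      (Finset.univ.filter (fun m : Fin n => k.succAbove m ∈ θ)) = slab α θ k {0} := by
  ext m
  constructor
  · rintro ⟨t, h0, h1, hm⟩
    refine ⟨0, rfl, t, fun i hi => h0 i (by simpa using hi), fun i hi => h1 i (by simpa using hi),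
      fun j => ?_⟩
    simpa using congrFun hm j
  · rintro ⟨s, rfl, t, h0, h1, hm⟩
    refine ⟨t, fun i hi => h0 i (by simpa using hi), fun i hi => h1 i (by simpa using hi), ?_⟩
    ext j
    simpa using hm j

end slab

/-- Half-open analogue of Lemma 3.4: for `k ∉ θ`,
`σ(𝒞^θ(A)) + σ(𝒞^θ(A[(k→−1)])) = σ(𝒞^θ(A[(k→𝟎)]))`, and
`σ(𝒞^{θ∪{k}}(A)) + σ(𝒞^{θ}(A[(k→−1)])) = 0`. -/
theorem sigma_halfopen_add_neg {d n : ℕ} (α : Fin (n + 1) → Fin d → ℤ)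
    (hα : LinearIndependent ℤ α) (θ : Finset (Fin (n + 1))) (k : Fin (n + 1))
    (hk : k ∉ θ) :
    (sigmaGF α θ + sigmaGF (Function.update α k (-α k)) θ =
      sigmaGF (fun m : Fin n => α (k.succAbove m))
        (Finset.univ.filter (fun m : Fin n => k.succAbove m ∈ θ))) ∧
    (sigmaGF α (insert k θ) + sigmaGF (Function.update α k (-α k)) θ = 0) := by
  have hv : α k ≠ 0 := hα.ne_zero k
  have hx1 : (1 : FracF d) - xpow (α k) ≠ 0 := sub_ne_zero.mpr (xpow_ne_one _ hv).symm
  have hinv : xpow (α k) * xpow (-α k) = 1 := by rw [← xpow_add, add_neg_cancel, xpow_zero]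
  have hx0 : xpow (α k) ≠ 0 := left_ne_zero_of_mul_eq_one hinv
  have hneg : xpow (-α k) = (xpow (α k))⁻¹ := eq_inv_of_mul_eq_one_right hinv
  have hfT := slab_finite α θ k (Set.Ioo 0 1) (by
    rintro s ⟨h1, h2⟩; rw [abs_le]; constructor <;> linarith)
  have hf0 := slab_finite α θ k {0} (by rintro s rfl; simp)
  have hf1 := slab_finite α θ k {1} (by rintro s rfl; simp)
  have hS : ∑ᶠ m ∈ slab α θ k (Set.Ico 0 1), xpow m =
      ∑ᶠ m ∈ slab α θ k {0}, xpow m + ∑ᶠ m ∈ slab α θ k (Set.Ioo 0 1), xpow m := by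
    have : Set.Ico (0 : ℝ) 1 = {0} ∪ Set.Ioo 0 1 := by
      rw [← Set.insert_eq, Set.Ioo_insert_left zero_lt_one]
    rw [this, slab_union, finsum_mem_union (slab_disjoint α θ k hα _ _ (by simp)) hf0 hfT]
  have hS' : ∑ᶠ m ∈ slab α θ k (Set.Ioc 0 1), xpow m =
      ∑ᶠ m ∈ slab α θ k {1}, xpow m + ∑ᶠ m ∈ slab α θ k (Set.Ioo 0 1), xpow m := by
    have : Set.Ioc (0 : ℝ) 1 = {1} ∪ Set.Ioo 0 1 := by
      rw [← Set.insert_eq, Set.Ioo_insert_right zero_lt_one]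
    rw [this, slab_union, finsum_mem_union (slab_disjoint α θ k hα _ _ (by simp)) hf1 hfT]
  have h1 := sum_shift α θ k {0} {1} (by intro s; simp)
  have hN := sum_shift α θ k (Set.Ioc (-1) 0) (Set.Ioc 0 1) (by
    intro s
    simp only [Set.mem_Ioc]
    constructor <;> rintro ⟨h1, h2⟩ <;> constructor <;> linarith)
  have hprod : ∏ i, (1 - xpow (Function.update α k (-α k) i)) =
      (1 - xpow (-α k)) * ∏ i, (1 - xpow (α (k.succAbove i))) := by
    rw [Fin.prod_univ_succAbove _ k]
    simp [Fin.succAbove_ne]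
  have hden : (1 : FracF d) - (xpow (α k))⁻¹ = -((1 - xpow (α k)) / xpow (α k)) := by
    field_simp
    ring
  unfold sigmaGF
  rw [parPts_eq α θ k hk, parPts_insert_eq α θ k hk, parPts_neg_eq α θ k hk, parPts_del_eq,
    hprod, Fin.prod_univ_succAbove (fun i => 1 - xpow (α i)) k, hneg, hden]
  rw [h1] at hS'
  generalize (∑ᶠ m ∈ slab α θ k (Set.Ioc (-1) 0), xpow m) = N at *
  generalize (∑ᶠ m ∈ slab α θ k (Set.Ioc 0 1), xpow m) = S' at *
  generalize (∑ᶠ m ∈ slab α θ k (Set.Ico 0 1), xpow m) = S at *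
  generalize (∑ᶠ m ∈ slab α θ k (Set.Ioo 0 1), xpow m) = T at *
  generalize (∑ᶠ m ∈ slab α θ k {0}, xpow m) = S0 at *
  generalize (∏ i, (1 - xpow (α (k.succAbove i)))) = D at *
  generalize xpow (α k) = x at *
  have hNT : N / (-((1 - x) / x) * D) = - (S' / ((1 - x) * D)) := by
    rw [hN]
    rw [div_mul_eq_div_div, div_mul_eq_div_div, div_neg, div_div_eq_mul_div]
    ring
  rw [hNT]
  refine ⟨?_, by ring⟩
  have : S - S' = (1 - x) * S0 := by rw [hS, hS']; ring
  rw [← sub_eq_add_neg, ← sub_div, this, mul_div_mul_left _ _ hx1]
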